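/- arXiv:1503.04098 — 4 statements merged into one kernel-verified Lean document; each statement's English description precedes it below -/
import Mathlib

section
/- (Jeffreys–Lindley paradox.) If the prior null probability is fixed at ρ₀(σ) = 1/2 for all σ > 0, then for every real x the posterior null probability P(σ,x) = (1 + (1/√(1+σ²))·exp(x²σ²/(2(1+σ²))))^{-1} converges to 1 as σ → ∞. -/
open Real Filter

theorem jeffreys_lindley_paradox (x : ℝ) :
    Tendsto (fun σ : ℝ =>
        (1 + (1 / Real.sqrt (1 + σ^2)) * Real.exp (x^2 * σ^2 / (2 * (1 + σ^2))))⁻¹)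
      atTop (nhds 1) := by
  have hsqrt : Tendsto (fun σ : ℝ => 1 / Real.sqrt (1 + σ^2)) atTop (nhds 0) := by
    simp only [one_div]
    exact (Real.tendsto_sqrt_atTop.comp
      (tendsto_atTop_add_const_left _ _ (tendsto_pow_atTop two_ne_zero))).inv_tendsto_atTop
  have hbound : ∀ σ : ℝ, Real.exp (x^2 * σ^2 / (2 * (1 + σ^2))) ≤ Real.exp (x^2 / 2) := by
    intro σ
    rw [Real.exp_le_exp, div_le_div_iff₀ (by positivity) two_pos]
    nlinarith [sq_nonneg x]
  have hterm : Tendsto (fun σ : ℝ =>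
      (1 / Real.sqrt (1 + σ^2)) * Real.exp (x^2 * σ^2 / (2 * (1 + σ^2)))) atTop (nhds 0) := by
    refine squeeze_zero (fun σ => by positivity)
      (fun σ => mul_le_mul_of_nonneg_left (hbound σ) (by positivity)) ?_
    simpa using hsqrt.mul_const (Real.exp (x^2 / 2))
  simpa using (hterm.const_add 1).inv₀ (by norm_num)
end

section
/- (Robert's choice.) Let ρ₀(σ) = 1/(1+√(2π)·σ) for σ > 0, and define m(σ) = ((1-ρ₀(σ))/ρ₀(σ)) · (1/√(1+σ²)) and, for x ∈ ℝ, P(σ,x) = (1 + m(σ)·exp(x²σ²/(2(1+σ²))))^{-1}. Then as σ → ∞: ρ₀(σ) → 0, m(σ) → √(2π), and for every real x, P(σ,x) → (1 + √(2π)·exp(x²/2))^{-1}, a limit strictly between 0 and 1. -/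
open Real Filter

theorem tendsto_sq_div_one_add_sq :
    Tendsto (fun σ : ℝ => σ ^ 2 / (1 + σ ^ 2)) atTop (nhds 1) := by
  have h : Tendsto (fun σ : ℝ => 1 - (1 + σ ^ 2)⁻¹) atTop (nhds (1 - 0)) :=
    (tendsto_inv_atTop_zero.comp
      (tendsto_atTop_add_const_left _ 1 (tendsto_pow_atTop two_ne_zero))).const_sub 1
  rw [sub_zero] at h
  refine h.congr fun σ => ?_
  have : 1 + σ ^ 2 ≠ 0 := by positivity
  field_simp
  ring

theorem odds_mul_inv_sqrt_eq {c σ : ℝ} (hc : 0 < c) (hσ : 0 < σ) :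
    (1 - 1 / (1 + c * σ)) / (1 / (1 + c * σ)) * (1 / √(1 + σ ^ 2)) =
      c * √(σ ^ 2 / (1 + σ ^ 2)) := by
  have : 1 + c * σ ≠ 0 := by positivity
  rw [sqrt_div (sq_nonneg σ), sqrt_sq hσ.le]
  field_simp
  ring

theorem robert_choice
    (ρ₀ : ℝ → ℝ) (hρ : ∀ σ > 0, ρ₀ σ = 1 / (1 + Real.sqrt (2 * π) * σ))
    (m : ℝ → ℝ) (hm : ∀ σ > 0, m σ = ((1 - ρ₀ σ) / ρ₀ σ) * (1 / Real.sqrt (1 + σ^2)))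
    (P : ℝ → ℝ → ℝ)
    (hP : ∀ σ > 0, ∀ x : ℝ, P σ x = (1 + m σ * Real.exp (x^2 * σ^2 / (2 * (1 + σ^2))))⁻¹) :
    Tendsto ρ₀ atTop (nhds 0) ∧
    Tendsto m atTop (nhds (Real.sqrt (2 * π))) ∧
    ∀ x : ℝ,
      Tendsto (fun σ => P σ x) atTop
        (nhds ((1 + Real.sqrt (2 * π) * Real.exp (x^2 / 2))⁻¹)) ∧
      0 < (1 + Real.sqrt (2 * π) * Real.exp (x^2 / 2))⁻¹ ∧
      (1 + Real.sqrt (2 * π) * Real.exp (x^2 / 2))⁻¹ < 1 := by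
  have hc : 0 < √(2 * π) := by positivity
  have hρ_lim : Tendsto ρ₀ atTop (nhds 0) := by
    have h : Tendsto (fun σ : ℝ => (1 + √(2 * π) * σ)⁻¹) atTop (nhds 0) :=
      tendsto_inv_atTop_zero.comp
        (tendsto_atTop_add_const_left _ 1 (tendsto_id.const_mul_atTop hc))
    refine h.congr' ?_
    filter_upwards [eventually_gt_atTop 0] with σ hσ
    rw [hρ σ hσ, one_div]
  have hm_lim : Tendsto m atTop (nhds (√(2 * π))) := by
    have h := tendsto_sq_div_one_add_sq.sqrt.const_mul (√(2 * π))
    rw [sqrt_one, mul_one] at h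
    refine h.congr' ?_
    filter_upwards [eventually_gt_atTop 0] with σ hσ
    rw [hm σ hσ, hρ σ hσ, odds_mul_inv_sqrt_eq hc hσ]
  refine ⟨hρ_lim, hm_lim, fun x => ⟨?_, by positivity, ?_⟩⟩
  · have he : Tendsto (fun σ : ℝ => x ^ 2 * σ ^ 2 / (2 * (1 + σ ^ 2))) atTop
        (nhds (x ^ 2 / 2)) := by
      have h := tendsto_sq_div_one_add_sq.const_mul (x ^ 2 / 2)
      rw [mul_one] at h
      exact h.congr fun σ => div_mul_div_comm _ _ _ _
    have h := ((hm_lim.mul he.rexp).const_add 1).inv₀ (by positivity)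
    refine h.congr' ?_
    filter_upwards [eventually_gt_atTop 0] with σ hσ
    rw [hP σ hσ]
  · exact inv_lt_one_of_one_lt₀ (lt_add_of_pos_right 1 (by positivity))
end

section
/- Fix A ∈ ℝ and define ψ(σ) = (2(1+σ²)/σ²)·(A - σ²/2 + (1/2)·log(1+σ²)) for σ > 0. Then ψ is strictly decreasing on the set {σ > 0 : ψ(σ) > 0}; that is, for all 0 < σ₁ < σ₂ with ψ(σ₁) > 0 and ψ(σ₂) > 0, ψ(σ₂) < ψ(σ₁). -/
open Real

theorem log_one_add_sub_log_one_add_lt {s t : ℝ} (hs : 0 < s) (hst : s < t) :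
    Real.log (1 + t) - Real.log (1 + s) < t - s := by
  rw [← Real.log_div (by linarith) (by linarith)]
  have h1 : Real.log ((1 + t) / (1 + s)) ≤ (1 + t) / (1 + s) - 1 :=
    Real.log_le_sub_one_of_pos (div_pos (by linarith) (by linarith))
  have h2 : (1 + t) / (1 + s) - 1 = (t - s) / (1 + s) := by
    field_simp
    ring
  have h3 : (t - s) / (1 + s) < t - s := div_lt_self (by linarith) (by linarith)
  linarith

theorem psi_strictly_decreasing_on_positive_part (A : ℝ)
    (ψ : ℝ → ℝ)
    (hψ : ∀ σ > 0, ψ σ = (2 * (1 + σ^2) / σ^2) * (A - σ^2 / 2 + (1/2) * Real.log (1 + σ^2))) :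
    ∀ σ₁ σ₂ : ℝ, 0 < σ₁ → σ₁ < σ₂ → 0 < ψ σ₁ → 0 < ψ σ₂ → ψ σ₂ < ψ σ₁ := by
  intro σ₁ σ₂ h₁ h₁₂ _ hpos
  have h₂ : 0 < σ₂ := h₁.trans h₁₂
  rw [hψ σ₂ h₂] at hpos ⊢
  rw [hψ σ₁ h₁]
  have hs : 0 < σ₁ ^ 2 := by positivity
  have hst : σ₁ ^ 2 < σ₂ ^ 2 := by gcongr
  have hlog := log_one_add_sub_log_one_add_lt hs hst
  have hfac : 2 * (1 + σ₂ ^ 2) / σ₂ ^ 2 ≤ 2 * (1 + σ₁ ^ 2) / σ₁ ^ 2 := by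
    rw [div_le_div_iff₀ (hs.trans hst) hs]
    linarith
  have hpos₂ := pos_of_mul_pos_right hpos (by positivity)
  exact mul_lt_mul' hfac (by linarith) hpos₂.le (by positivity)
end

section
/- Fix A ∈ ℝ and define ψ(σ) = (2(1+σ²)/σ²)·(A - σ²/2 + (1/2)·log(1+σ²)) for σ > 0, and let Φ denote the standard normal cumulative distribution function. Then the Type I error map σ ↦ 2·(1 - Φ(√(ψ(σ)))) is strictly increasing on the set {σ > 0 : ψ(σ) > 0}; hence on this set there is a one-to-one correspondence between σ and the Type I error α = 2·(1 - Φ(√(ψ(σ)))). -/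
open Real MeasureTheory ProbabilityTheory

/-- The distribution function of a finite measure on the line which charges every
Lebesgue-non-null set is strictly increasing. -/
lemma strictMono_measureReal_Iic_of_volume_absolutelyContinuous (μ : Measure ℝ)
    [IsFiniteMeasure μ] (hμ : volume ≪ μ) : StrictMono fun t => μ.real (Set.Iic t) := by
  intro a b hab
  have hpos : 0 < μ.real (Set.Ioc a b) := by
    refine ENNReal.toReal_pos (fun h => ?_) (measure_ne_top _ _)
    have h0 := hμ h
    rw [Real.volume_Ioc, ENNReal.ofReal_eq_zero] at h0
    linarith
  have hunion : μ.real (Set.Iic b) = μ.real (Set.Iic a) + μ.real (Set.Ioc a b) := by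
    rw [← Set.Iic_union_Ioc_eq_Iic hab.le]
    exact measureReal_union (Set.Iic_disjoint_Ioc le_rfl) measurableSet_Ioc
  simp only [hunion]
  linarith

lemma log_one_add_sub_log_one_add_lt_s16 {u v : ℝ} (hu : 0 < u) (huv : u < v) :
    Real.log (1 + v) - Real.log (1 + u) < v - u := by
  rw [← Real.log_div (by linarith) (by linarith)]
  have hlog := Real.log_le_sub_one_of_pos 
    (div_pos (add_pos one_pos (hu.trans huv)) (add_pos one_pos hu))
  have hlt : (1 + v) / (1 + u) - 1 < v - u := by
    rw [sub_lt_iff_lt_add, div_lt_iff₀ (by linarith)]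
    nlinarith
  linarith

lemma rejection_boundary_lt (A : ℝ) {u v : ℝ} (hu : 0 < u) (huv : u < v)
    (hv : 0 < 2 * (1 + v) / v * (A - v / 2 + (1 / 2) * Real.log (1 + v))) :
    2 * (1 + v) / v * (A - v / 2 + (1 / 2) * Real.log (1 + v)) <
      2 * (1 + u) / u * (A - u / 2 + (1 / 2) * Real.log (1 + u)) := by
  have hv0 : 0 < v := hu.trans huv
  have hfactor : 0 < 2 * (1 + v) / v := by positivity
  have hlog := log_one_add_sub_log_one_add_lt_s16 hu huv
  have hpos := (mul_pos_iff_of_pos_left hfactor).1 hv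
  have hle : 2 * (1 + v) / v ≤ 2 * (1 + u) / u := by
    rw [div_le_div_iff₀ hv0 hu]
    nlinarith
  exact mul_lt_mul' hle (by linarith) hpos.le (hfactor.trans_le hle)

theorem type_one_error_strictMono (A : ℝ)
    (ψ : ℝ → ℝ)
    (hψ : ∀ σ > 0, ψ σ = (2 * (1 + σ^2) / σ^2) * (A - σ^2 / 2 + (1/2) * Real.log (1 + σ^2)))
    (Φ : ℝ → ℝ) (hΦ : ∀ t : ℝ, Φ t = (gaussianReal 0 1 (Set.Iic t)).toReal) :
    StrictMonoOn (fun σ => 2 * (1 - Φ (Real.sqrt (ψ σ)))) {σ : ℝ | 0 < σ ∧ 0 < ψ σ} ∧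
    Set.InjOn (fun σ => 2 * (1 - Φ (Real.sqrt (ψ σ)))) {σ : ℝ | 0 < σ ∧ 0 < ψ σ} := by
  have hΦmono : StrictMono Φ := by
    rw [funext hΦ]
    exact strictMono_measureReal_Iic_of_volume_absolutelyContinuous _
      (gaussianReal_absolutelyContinuous' 0 one_ne_zero)
  have hmono : StrictMonoOn (fun σ => 2 * (1 - Φ (Real.sqrt (ψ σ))))
      {σ : ℝ | 0 < σ ∧ 0 < ψ σ} := by
    rintro s ⟨hs, -⟩ t ⟨ht, hψt⟩ hst
    have hlt : ψ t < ψ s := by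
      rw [hψ t ht] at hψt ⊢
      rw [hψ s hs]
      exact rejection_boundary_lt A (by positivity) (by gcongr) hψt
    have hΦlt := hΦmono (Real.sqrt_lt_sqrt hψt.le hlt)
    dsimp only
    linarith
  exact ⟨hmono, hmono.injOn⟩
end
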